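/- arXiv:2506.22317 — 2 statements merged into one kernel-verified Lean document; each statement's English description precedes it below -/
import Mathlib

section
/- The average size of a maximal independent set in the grid Möbius strip M_{2×n} satisfies A(M_{2×n}) = (φ/√5)·n + o(1); that is, lim_{n→∞} ( A(M_{2×n}) − (φ/√5)·n ) = 0, where φ = (1+√5)/2. -/
open SimpleGraph Finset

/-- A maximal independent set of a simple graph, as a `Finset` of vertices. -/
def IsMaxIndep {V : Type*} (G : SimpleGraph V) (s : Finset V) : Prop :=
  (∀ ⦃u⦄, u ∈ s → ∀ ⦃v⦄, v ∈ s → ¬ G.Adj u v) ∧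
  ∀ t : Finset V, (∀ ⦃u⦄, u ∈ t → ∀ ⦃v⦄, v ∈ t → ¬ G.Adj u v) → s ⊆ t → s = t

/-- The finite set of all maximal independent sets of `G`. -/
noncomputable def misFinset {V : Type*} [Fintype V] (G : SimpleGraph V) : Finset (Finset V) := by
  classical exact Finset.univ.filter (IsMaxIndep G)

/-- The number of orbits of maximal independent sets of `G` under the action of the
automorphism group of `G`. -/
noncomputable def nimisCard {V : Type*} [Fintype V] [DecidableEq V] (G : SimpleGraph V) : ℕ :=
  Nat.card (Quot (fun M N : {s : Finset V // IsMaxIndep G s} =>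
    ∃ e : G ≃g G, (M : Finset V).image e = (N : Finset V)))

/-- The grid graph `G_{m×n}`, the box product of two path graphs. -/
def gridGraph (m n : ℕ) : SimpleGraph (Fin m × Fin n) := pathGraph m □ pathGraph n

/-- The grid Möbius strip `M_{m×n}` on vertex set `Fin n × Fin m` (0-indexed version of
`{1,…,n} × {1,…,m}`): edges at Manhattan distance 1, plus the twisted wrap-around edges
joining `(1,i)` to `(n, m+1-i)`. -/
def mobiusGraph (m n : ℕ) : SimpleGraph (Fin n × Fin m) :=
  SimpleGraph.fromRel (fun p q =>
    ((p.1 : ℕ) + 1 = (q.1 : ℕ) ∧ p.2 = q.2) ∨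
    (p.1 = q.1 ∧ (p.2 : ℕ) + 1 = (q.2 : ℕ)) ∨
    ((p.1 : ℕ) = 0 ∧ (q.1 : ℕ) = n - 1 ∧ (p.2 : ℕ) + (q.2 : ℕ) = m - 1))

/-- The average size of a maximal independent set of `G`. -/
noncomputable def avgMIS {V : Type*} [Fintype V] (G : SimpleGraph V) : ℝ :=
  (∑ M ∈ misFinset G, (M.card : ℝ)) / ((misFinset G).card : ℝ)

open Polynomial

theorem mem_misFinset {V : Type*} [Fintype V] {G : SimpleGraph V} {s : Finset V} :
    s ∈ misFinset G ↔ IsMaxIndep G s := by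
  simp [misFinset]

/-- Maximality of an independent set means that every outside vertex has a neighbour inside. -/
theorem isMaxIndep_iff {V : Type*} [DecidableEq V] {G : SimpleGraph V} {s : Finset V} :
    IsMaxIndep G s ↔ (∀ ⦃u⦄, u ∈ s → ∀ ⦃v⦄, v ∈ s → ¬ G.Adj u v) ∧
      ∀ u, u ∉ s → ∃ v ∈ s, G.Adj u v := by
  refine and_congr_right fun hs => ⟨fun h u hu => ?_, fun h t ht hst => ?_⟩
  · by_contra! hv
    refine hu ?_
    rw [h (insert u s) ?_ (Finset.subset_insert u s)]
    · exact Finset.mem_insert_self u s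
    · intro a ha b hb
      rcases Finset.mem_insert.1 ha with rfl | ha' <;>
        rcases Finset.mem_insert.1 hb with rfl | hb'
      · exact G.loopless.irrefl _
      · exact hv b hb'
      · exact fun hab => hv a ha' hab.symm
      · exact hs ha' hb'
  · refine hst.antisymm fun u hu => ?_
    by_contra hus
    obtain ⟨v, hv, huv⟩ := h u hus
    exact ht hu (hst hv) huv

/-- Entries of a matrix power as sums over words of indices. -/
theorem Matrix.pow_succ_apply_eq_sum_words {S R : Type*} [Fintype S] [DecidableEq S] [CommRing R]
    (A : Matrix S S R) (n : ℕ) (a b : S) :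
    (A ^ (n + 1)) a b = ∑ w : Fin n → S, ∏ i : Fin (n + 1),
      A (Fin.cons (α := fun _ => S) a w i) (Fin.snoc (α := fun _ => S) w b i) := by
  induction n generalizing a with
  | zero => simp [Fin.snoc]
  | succ n ih =>
    rw [pow_succ', Matrix.mul_apply, ← (Fin.consEquiv fun _ => S).sum_comp,
      Fintype.sum_prod_type]
    refine Finset.sum_congr rfl fun c _ => ?_
    rw [ih, Finset.mul_sum]
    refine Finset.sum_congr rfl fun w _ => ?_
    simp only [Fin.consEquiv, Equiv.coe_fn_mk]
    rw [← Fin.cons_snoc_eq_snoc_cons, Fin.prod_univ_succ (n := n + 1)]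
    simp only [Fin.cons_zero, Fin.cons_succ]

namespace Mobius

variable {n : ℕ}

/-- The other vertex in the same column of the width two Möbius strip. -/
def flip (p : Fin (n + 1) × Fin 2) : Fin (n + 1) × Fin 2 := (p.1, p.2.rev)

/-- The horizontal successor of a vertex of the width two Möbius strip. -/
def next (p : Fin (n + 1) × Fin 2) : Fin (n + 1) × Fin 2 :=
  Fin.snoc (α := fun _ => Fin (n + 1) × Fin 2) (fun j : Fin n => (j.succ, p.2)) (0, p.2.rev) p.1

/-- The horizontal predecessor of a vertex of the width two Möbius strip. -/
def prev (p : Fin (n + 1) × Fin 2) : Fin (n + 1) × Fin 2 :=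
  Fin.cons (α := fun _ => Fin (n + 1) × Fin 2) (Fin.last n, p.2.rev)
    (fun j : Fin n => (j.castSucc, p.2)) p.1

theorem next_castSucc (j : Fin n) (l : Fin 2) : next (j.castSucc, l) = (j.succ, l) := by
  simp [next]

theorem next_last (l : Fin 2) : next (Fin.last n, l) = (0, l.rev) := by
  simp [next]

theorem flip_flip (p : Fin (n + 1) × Fin 2) : flip (flip p) = p := by
  simp [flip]

theorem next_flip (p : Fin (n + 1) × Fin 2) : next (flip p) = flip (next p) := by
  obtain ⟨i, l⟩ := p
  induction i using Fin.lastCases <;> simp [flip, next]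

theorem prev_flip (p : Fin (n + 1) × Fin 2) : prev (flip p) = flip (prev p) := by
  obtain ⟨i, l⟩ := p
  induction i using Fin.cases <;> simp [flip, prev]

theorem next_prev (p : Fin (n + 1) × Fin 2) : next (prev p) = p := by
  obtain ⟨i, l⟩ := p
  induction i using Fin.cases <;> simp [next, prev]

theorem prev_next (p : Fin (n + 1) × Fin 2) : prev (next p) = p := by
  obtain ⟨i, l⟩ := p
  induction i using Fin.lastCases <;> simp [next, prev]

theorem eq_next_iff {p q : Fin (n + 1) × Fin 2} :
    q = next p ↔ ((p.1 : ℕ) + 1 = q.1 ∧ p.2 = q.2) ∨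
      ((q.1 : ℕ) = 0 ∧ (p.1 : ℕ) = n ∧ (q.2 : ℕ) + p.2 = 1) := by
  obtain ⟨i, l⟩ := p
  obtain ⟨j, m⟩ := q
  induction i using Fin.lastCases with
  | last =>
    have hj := j.isLt
    have hm := m.isLt
    simp only [next_last, Prod.mk.injEq, Fin.ext_iff, Fin.val_rev, Fin.val_last, Fin.val_zero,
      true_and]
    omega
  | cast i =>
    have hi := i.isLt
    simp only [next_castSucc, Prod.mk.injEq, Fin.ext_iff, Fin.val_succ, Fin.val_castSucc]
    omega

theorem next_ne (p : Fin (n + 1) × Fin 2) : p ≠ next p := by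
  rw [Ne, eq_next_iff]
  omega

theorem flip_ne (p : Fin (n + 1) × Fin 2) : p ≠ flip p := by
  obtain ⟨i, l⟩ := p
  simp only [flip, Ne, Prod.mk.injEq, Fin.ext_iff, Fin.val_rev]
  omega

theorem adj_iff {p q : Fin (n + 1) × Fin 2} :
    (mobiusGraph 2 (n + 1)).Adj p q ↔ q = next p ∨ q = prev p ∨ q = flip p := by
  have hprev : q = prev p ↔ p = next q :=
    ⟨fun h => by rw [h, next_prev], fun h => by rw [h, prev_next]⟩
  have hflip : q = flip p ↔ p.1 = q.1 ∧ ((p.2 : ℕ) + 1 = q.2 ∨ (q.2 : ℕ) + 1 = p.2) := by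
    obtain ⟨i, l⟩ := p
    obtain ⟨j, m⟩ := q
    simp only [flip, Prod.mk.injEq, Fin.ext_iff, Fin.val_rev]
    omega
  have hne : q = next p ∨ q = prev p ∨ q = flip p → p ≠ q := by
    rw [hprev]
    rintro (h | h | h)
    · exact h ▸ next_ne p
    · exact h ▸ (next_ne q).symm
    · exact h ▸ flip_ne p
  rw [mobiusGraph, SimpleGraph.fromRel_adj]
  refine ⟨fun ⟨_, h⟩ => ?_, fun h => ⟨hne h, ?_⟩⟩
  · rw [hprev, eq_next_iff, eq_next_iff, hflip]
    grind
  · rw [hprev, eq_next_iff, eq_next_iff, hflip] at h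
    grind

theorem isMaxIndep_mobius_iff {M : Finset (Fin (n + 1) × Fin 2)} :
    IsMaxIndep (mobiusGraph 2 (n + 1)) M ↔
      (∀ p ∈ M, next p ∉ M ∧ flip p ∉ M) ∧
      ∀ p ∉ M, next p ∈ M ∨ prev p ∈ M ∨ flip p ∈ M := by
  rw [isMaxIndep_iff]
  refine and_congr ⟨fun h p hp => ?_, fun h p hp q hq hpq => ?_⟩
    (forall₂_congr fun p _ => by simp [adj_iff, and_or_left, exists_or])
  · exact ⟨fun hq => h hp hq (adj_iff.2 (.inl rfl)),
      fun hq => h hp hq (adj_iff.2 (.inr (.inr rfl)))⟩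
  · rcases adj_iff.1 hpq with rfl | rfl | rfl
    · exact (h p hp).1 hq
    · exact (h _ hq).1 (by rwa [next_prev])
    · exact (h p hp).2 hq

/-- The state of a column: the row of the last chosen vertex up to and including that column,
and whether that vertex lies in the column itself. -/
abbrev State := Fin 2 × Bool

/-- The state obtained by exchanging the two rows. -/
def State.swap (a : State) : State := (a.1.rev, a.2)

/-- The possible pairs of states of consecutive columns. -/
def Step (a b : State) : Prop := if b.2 then b.1 ≠ a.1 else b.1 = a.1 ∧ a.2

instance : DecidableRel Step := fun a b => by unfold Step; infer_instance

/-- The states of the following columns, going around the strip with its twist. -/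
def shift (w : Fin (n + 1) → State) : Fin (n + 1) → State :=
  Fin.snoc (α := fun _ => State) (Fin.tail w) (w 0).swap

/-- The vertices chosen by a word of states. -/
def chosen (w : Fin (n + 1) → State) : Finset (Fin (n + 1) × Fin 2) :=
  Finset.univ.filter fun p => w p.1 = (p.2, true)

theorem mem_chosen {w : Fin (n + 1) → State} {p : Fin (n + 1) × Fin 2} :
    p ∈ chosen w ↔ (w p.1).1 = p.2 ∧ (w p.1).2 = true := by
  simp [chosen, Prod.ext_iff]

theorem card_chosen (w : Fin (n + 1) → State) :
    (chosen w).card = ∑ i, if (w i).2 then 1 else 0 := by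
  rw [chosen, Finset.card_filter, Fintype.sum_prod_type]
  refine Finset.sum_congr rfl fun i _ => ?_
  obtain ⟨l, o, hw⟩ : ∃ l o, w i = (l, o) := ⟨_, _, rfl⟩
  cases o <;> simp [hw, Prod.ext_iff]

theorem eq_rev_iff_ne (a b : Fin 2) : a = b.rev ↔ a ≠ b := by
  decide +revert

theorem fst_shift_eq_iff (w : Fin (n + 1) → State) (p : Fin (n + 1) × Fin 2) :
    (shift w p.1).1 = p.2 ↔ (w (next p).1).1 = (next p).2 := by
  obtain ⟨i, l⟩ := p
  induction i using Fin.lastCases with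
  | last => simp [shift, next, State.swap, Fin.rev_eq_iff]
  | cast i => simp [shift, next, Fin.tail]

theorem snd_shift (w : Fin (n + 1) → State) (p : Fin (n + 1) × Fin 2) :
    (shift w p.1).2 = (w (next p).1).2 := by
  obtain ⟨i, l⟩ := p
  induction i using Fin.lastCases with
  | last => simp [shift, next, State.swap]
  | cast i => simp [shift, next, Fin.tail]

theorem forall_step_iff {w : Fin (n + 1) → State} :
    (∀ i, Step (w i) (shift w i)) ↔
      ∀ p : Fin (n + 1) × Fin 2, (w (next p).1).1 = (next p).2 →
        if (w (next p).1).2 then (w p.1).1 ≠ p.2 else (w p.1).1 = p.2 ∧ (w p.1).2 := by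
  simp_rw [← fst_shift_eq_iff, ← snd_shift]
  refine ⟨fun h p hp => ?_, fun h i => ?_⟩
  · have := h p.1
    grind [Step]
  · have := h (i, (shift w i).1) rfl
    grind [Step]

theorem fst_flip (p : Fin (n + 1) × Fin 2) : (flip p).1 = p.1 := rfl

theorem row_flip_iff (w : Fin (n + 1) → State) (p : Fin (n + 1) × Fin 2) :
    (w p.1).1 = (flip p).2 ↔ (w p.1).1 ≠ p.2 :=
  eq_rev_iff_ne _ _

theorem chosen_isMaxIndep {w : Fin (n + 1) → State} (hw : ∀ i, Step (w i) (shift w i)) :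
    IsMaxIndep (mobiusGraph 2 (n + 1)) (chosen w) := by
  rw [forall_step_iff] at hw
  rw [isMaxIndep_mobius_iff]
  simp only [mem_chosen, fst_flip, row_flip_iff]
  refine ⟨fun p hp => ⟨fun hq => ?_, fun hq => hq.1 hp.1⟩, fun p hp => ?_⟩
  · simpa [hq.2, hp.1] using hw p hq.1
  · by_cases ho : (w p.1).2 = true
    · exact .inr (.inr ⟨fun h => hp ⟨h, ho⟩, ho⟩)
    · by_cases hl : (w p.1).1 = p.2
      · have h := hw (prev p)
        rw [next_prev] at h
        exact .inr (.inl (by simpa [ho] using h hl))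
      · have h := hw p
        have h' := hw (flip p)
        simp only [next_flip, fst_flip, ne_eq, row_flip_iff] at h'
        clear hw
        grind

theorem chosen_injOn :
    Set.InjOn chosen {w : Fin (n + 1) → State | ∀ i, Step (w i) (shift w i)} := by
  intro v hv w hw h
  have hv' := forall_step_iff.1 hv
  have hw' := forall_step_iff.1 hw
  have hmem (p : Fin (n + 1) × Fin 2) :
      ((v p.1).1 = p.2 ∧ (v p.1).2 = true) ↔ ((w p.1).1 = p.2 ∧ (w p.1).2 = true) := by
    rw [← mem_chosen, ← mem_chosen, h]
  funext i
  have hi := hmem (i, (v i).1)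
  have hi' := hmem (i, (w i).1)
  by_cases ho : (v i).2 = true
  · grind
  · have ho' : ¬ (w i).2 = true := by grind
    have h1 := hv' (prev (i, (v i).1))
    have h2 := hw' (prev (flip (i, (v i).1)))
    have h3 := hmem (prev (i, (v i).1))
    rw [next_prev] at h1 h2
    simp only [prev_flip, fst_flip, ne_eq, row_flip_iff] at h2
    have hr := row_flip_iff w (i, (v i).1)
    clear hv hw hv' hw' hmem
    grind

open Classical in
/-- The word of states of a maximal independent set. -/
noncomputable def word (M : Finset (Fin (n + 1) × Fin 2)) (i : Fin (n + 1)) : State :=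
  if (i, 0) ∈ M then (0, true) else if (i, 1) ∈ M then (1, true)
  else if prev (i, 0) ∈ M then (0, false) else (1, false)

theorem word_snd_iff (M : Finset (Fin (n + 1) × Fin 2)) (p : Fin (n + 1) × Fin 2) :
    (word M p.1).2 = true ↔ p ∈ M ∨ flip p ∈ M := by
  obtain ⟨i, l⟩ := p
  fin_cases l <;> simp [word, flip] <;> grind

theorem word_fst_iff {M : Finset (Fin (n + 1) × Fin 2)}
    (hM : IsMaxIndep (mobiusGraph 2 (n + 1)) M) (p : Fin (n + 1) × Fin 2) :
    (word M p.1).1 = p.2 ↔ p ∈ M ∨ (p ∉ M ∧ flip p ∉ M ∧ prev p ∈ M) := by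
  rw [isMaxIndep_mobius_iff] at hM
  obtain ⟨hind, hmax⟩ := hM
  have key (i : Fin (n + 1)) (h0 : (i, 0) ∉ M) (h1 : (i, 1) ∉ M) :
      prev (i, 1) ∈ M ↔ prev (i, 0) ∉ M := by
    have hf : flip (i, (0 : Fin 2)) = (i, 1) := rfl
    have m0 := hmax _ h0
    have m1 := hmax _ h1
    rw [← hf] at m1 h1 ⊢
    rw [next_flip, prev_flip, flip_flip] at m1
    rw [prev_flip]
    have := hind (prev (i, 0))
    have := hind (next (i, 0))
    grind
  obtain ⟨i, l⟩ := p
  have k := key i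
  have hi0 := hind (i, 0)
  have hi1 := hind (i, 1)
  have hf : flip (i, (0 : Fin 2)) = (i, 1) := rfl
  have hf' : flip (i, (1 : Fin 2)) = (i, 0) := rfl
  fin_cases l <;> simp only [word, Fin.zero_eta, Fin.mk_one, hf, hf'] at * <;> grind

theorem step_word_and_chosen_word {M : Finset (Fin (n + 1) × Fin 2)}
    (hM : IsMaxIndep (mobiusGraph 2 (n + 1)) M) :
    (∀ i, Step (word M i) (shift (word M) i)) ∧ chosen (word M) = M := by
  have hfst := word_fst_iff hM
  rw [isMaxIndep_mobius_iff] at hM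
  obtain ⟨hind, hmax⟩ := hM
  constructor
  · rw [forall_step_iff]
    intro p
    have h1 := hind p
    have h2 := hind (prev p)
    have h3 := hind (next p)
    have h4 := hind (flip p)
    have h5 := hmax p
    have h6 := hmax (flip p)
    rw [next_flip, flip_flip] at h4
    rw [next_flip, prev_flip, flip_flip] at h6
    have h7 := hfst (next p)
    rw [prev_next] at h7
    have h8 := word_snd_iff M (next p)
    have h9 := hfst p
    have h10 := word_snd_iff M p
    grind
  · ext p
    rw [mem_chosen, hfst, word_snd_iff]
    tauto

/-- The transfer matrix of the strip, with weight `x` for each chosen vertex. -/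
def transfer {R : Type*} [CommRing R] (x : R) : Matrix State State R :=
  fun a b => if Step a b then if a.2 then x else 1 else 0

/-- The twisted trace of a power of the transfer matrix. -/
def twistedTrace {R : Type*} [CommRing R] (x : R) (n : ℕ) : R :=
  ∑ a : State, (transfer x ^ n) a a.swap

theorem sum_pow_card_misFinset {R : Type*} [CommRing R] (x : R) (n : ℕ) :
    ∑ M ∈ misFinset (mobiusGraph 2 (n + 1)), x ^ M.card = twistedTrace x (n + 1) := by
  have hsum : ∑ w : Fin (n + 1) → State with ∀ i, Step (w i) (shift w i), x ^ (chosen w).card =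
      ∑ M ∈ misFinset (mobiusGraph 2 (n + 1)), x ^ M.card := by
    refine Finset.sum_nbij chosen (fun w hw => ?_) (fun v hv w hw h => ?_) (fun M hM => ?_)
      fun _ _ => rfl
    · exact mem_misFinset.2 (chosen_isMaxIndep (by simpa using hw))
    · exact chosen_injOn (by simpa using hv) (by simpa using hw) h
    · have h := step_word_and_chosen_word (mem_misFinset.1 hM)
      exact ⟨word M, by simpa using h.1, h.2⟩
  simp only [twistedTrace, Matrix.pow_succ_apply_eq_sum_words]
  rw [← hsum, Finset.sum_filter, ← (Fin.consEquiv fun _ => State).sum_comp,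
    Fintype.sum_prod_type]
  refine Finset.sum_congr rfl fun a _ => Finset.sum_congr rfl fun w _ => ?_
  simp only [Fin.consEquiv_apply, transfer, Finset.prod_ite_zero, Finset.mem_univ, true_imp_iff,
    card_chosen, ← Finset.prod_pow_eq_pow_sum, shift, Fin.cons_zero]
  congr 1
  refine Finset.prod_congr rfl fun i _ => ?_
  split_ifs <;> simp

theorem transfer_pow_four {R : Type*} [CommRing R] (x : R) :
    transfer x ^ 4 = x ^ 2 • (transfer x ^ 2 + (transfer x + transfer x) + 1) := by
  rw [show 4 = 2 + 2 from rfl, pow_add, pow_two (transfer x)]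
  ext ⟨i, a⟩ ⟨j, b⟩
  fin_cases i <;> fin_cases j <;> cases a <;> cases b <;>
    simp [Matrix.mul_apply, Fintype.sum_prod_type, transfer, Step] <;> ring

theorem twistedTrace_add_four {R : Type*} [CommRing R] (x : R) (n : ℕ) :
    twistedTrace x (n + 4) =
      x ^ 2 * (twistedTrace x (n + 2) + 2 * twistedTrace x (n + 1) + twistedTrace x n) := by
  have h : transfer x ^ (n + 4) =
      x ^ 2 • (transfer x ^ (n + 2) + (transfer x ^ (n + 1) + transfer x ^ (n + 1)) +
        transfer x ^ n) := by
    simp only [pow_add _ n, transfer_pow_four, mul_smul_comm, mul_add, pow_one, mul_one]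
  simp only [twistedTrace, h, Matrix.smul_apply, Matrix.add_apply, Finset.mul_sum,
    ← Finset.sum_add_distrib, smul_eq_mul, two_mul]

theorem twistedTrace_zero {R : Type*} [CommRing R] (x : R) : twistedTrace x 0 = 0 := by
  simp [twistedTrace, Fintype.sum_prod_type, Fin.sum_univ_two, State.swap, Matrix.one_apply,
    -Finset.sum_boole]

theorem twistedTrace_one {R : Type*} [CommRing R] (x : R) : twistedTrace x 1 = 2 * x := by
  simp [twistedTrace, Fintype.sum_prod_type, State.swap, transfer, Step]
  ring

theorem twistedTrace_two {R : Type*} [CommRing R] (x : R) : twistedTrace x 2 = 4 * x := by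
  simp [twistedTrace, Fintype.sum_prod_type, State.swap, transfer, Step, pow_succ,
    Matrix.mul_apply]
  ring

theorem twistedTrace_three {R : Type*} [CommRing R] (x : R) : twistedTrace x 3 = 2 * x ^ 3 := by
  simp [twistedTrace, Fintype.sum_prod_type, State.swap, transfer, Step, pow_succ,
    Matrix.mul_apply]
  ring


/-- The periodic sequence `-1, 1, 0, -1, 1, 0, …`. -/
def periodicSeq : ℕ → ℝ
  | 0 => -1
  | 1 => 1
  | n + 2 => -periodicSeq (n + 1) - periodicSeq n

theorem periodicSeq_add_three (n : ℕ) : periodicSeq (n + 3) = periodicSeq n := by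
  rw [periodicSeq, periodicSeq]
  ring

theorem abs_periodicSeq_le_one (n : ℕ) : |periodicSeq n| ≤ 1 := by
  induction n using Nat.strong_induction_on with
  | _ n ih =>
    match n with
    | 0 | 1 | 2 => norm_num [periodicSeq]
    | n + 3 => exact periodicSeq_add_three n ▸ ih n (by omega)

theorem eval_one_twistedTrace (n : ℕ) :
    (twistedTrace (X : ℝ[X]) n).eval 1 =
      2 * Nat.fib (n + 1) - Nat.fib n - (periodicSeq (n + 1) - periodicSeq n) := by
  induction n using Nat.strong_induction_on with
  | _ n ih =>
    match n with
    | 0 => norm_num [twistedTrace_zero, periodicSeq]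
    | 1 => norm_num [twistedTrace_one, periodicSeq]
    | 2 => norm_num [twistedTrace_two, periodicSeq, Nat.fib_add_two]
    | 3 => norm_num [twistedTrace_three, periodicSeq, Nat.fib_add_two]
    | n + 4 =>
      rw [twistedTrace_add_four]
      simp only [eval_mul, eval_add, eval_pow, eval_X, eval_ofNat, ih n (by omega),
        ih (n + 1) (by omega), ih (n + 2) (by omega), Nat.fib_add_two, periodicSeq]
      push_cast
      ring

theorem eval_one_derivative_twistedTrace (n : ℕ) :
    (derivative (twistedTrace (X : ℝ[X]) n)).eval 1 =
      n * (Nat.fib (n + 1) + periodicSeq n) := by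
  induction n using Nat.strong_induction_on with
  | _ n ih =>
    match n with
    | 0 => norm_num [twistedTrace_zero]
    | 1 => norm_num [twistedTrace_one, periodicSeq]
    | 2 => norm_num [twistedTrace_two, periodicSeq, Nat.fib_add_two]
    | 3 => norm_num [twistedTrace_three, periodicSeq, Nat.fib_add_two]
    | n + 4 =>
      rw [twistedTrace_add_four]
      simp only [derivative_mul, derivative_add, derivative_X_pow, derivative_ofNat, eval_C,
        eval_mul, eval_add, eval_pow, eval_X, eval_ofNat, eval_zero, eval_one_twistedTrace,
        ih n (by omega), ih (n + 1) (by omega), ih (n + 2) (by omega), Nat.fib_add_two,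
        periodicSeq]
      push_cast
      ring

theorem avgMIS_mobius (n : ℕ) :
    avgMIS (mobiusGraph 2 (n + 1)) =
      (derivative (twistedTrace (X : ℝ[X]) (n + 1))).eval 1 /
        (twistedTrace (X : ℝ[X]) (n + 1)).eval 1 := by
  simp [avgMIS, ← sum_pow_card_misFinset, eval_finsetSum, derivative_X_pow]

open Real goldenRatio in
theorem abs_avgMIS_sub_le {n : ℕ} (hn : 0 < n) (h : 6 ≤ φ ^ n) :
    |avgMIS (mobiusGraph 2 n) - ((1 + √5) / 2 / √5) * n| ≤ 8 * (n / φ ^ n) := by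
  have h2 : 2 ≤ √5 := le_sqrt_of_sq_le (by norm_num)
  obtain ⟨m, rfl⟩ := Nat.exists_eq_add_of_le' hn
  rw [avgMIS_mobius, eval_one_twistedTrace, eval_one_derivative_twistedTrace]
  generalize m + 1 = n at h
  have hu := abs_le.1 (abs_periodicSeq_le_one n)
  have hu' := abs_le.1 (abs_periodicSeq_le_one (n + 1))
  have hψ : |ψ ^ n| ≤ 1 := by
    rw [abs_pow]
    refine pow_le_one₀ (abs_nonneg _) (abs_le.2 ⟨neg_one_lt_goldenConj.le, ?_⟩)
    exact goldenConj_neg.le.trans zero_le_one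
  have hψ' := abs_le.1 hψ
  have e1 := fib_succ_sub_goldenRatio_mul_fib n
  have e2 := fib_succ_sub_goldenConj_mul_fib n
  have hL : 2 * (Nat.fib (n + 1) : ℝ) - Nat.fib n = φ ^ n + ψ ^ n := by
    linear_combination e1 + e2 + (Nat.fib n : ℝ) * goldenRatio_add_goldenConj
  set c := (1 + √5) / 2 / √5 with hc
  set t := periodicSeq (n + 1) - periodicSeq n with ht
  have hc0 : 0 ≤ c := by positivity
  have hc1 : c ≤ 1 := by
    rw [hc, div_le_one (by positivity)]
    linarith
  have hF : (Nat.fib (n + 1) : ℝ) - c * (φ ^ n + ψ ^ n) = -(ψ ^ n / √5) := by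
    rw [coe_fib_eq, pow_succ, pow_succ, hc, ← goldenRatio]
    linear_combination -(ψ ^ n / √5) * goldenRatio_add_goldenConj
  have hψ5 : |ψ ^ n / √5| ≤ 1 := by
    rw [abs_div, abs_of_pos (by positivity : 0 < √5)]
    exact (div_le_one (by positivity)).2 (by linarith)
  have hD : φ ^ n / 2 ≤ φ ^ n + ψ ^ n - t := by linarith
  have hct : |c * t| ≤ 2 := by
    rw [abs_mul, abs_of_nonneg hc0]
    calc c * |t| ≤ 1 * 2 := by
          gcongr
          exact abs_le.2 ⟨by linarith, by linarith⟩
      _ = 2 := by norm_num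
  have hpos : 0 < φ ^ n := by positivity
  have hDpos : 0 < φ ^ n + ψ ^ n - t := by linarith
  have hnum : n * (Nat.fib (n + 1) + periodicSeq n) / (φ ^ n + ψ ^ n - t) - c * n =
      n * (-(ψ ^ n / √5) + periodicSeq n + c * t) / (φ ^ n + ψ ^ n - t) := by
    rw [← hF]
    field_simp
    ring
  rw [hL, hnum, abs_div, abs_of_pos hDpos, abs_mul, Nat.abs_cast]
  calc n * |-(ψ ^ n / √5) + periodicSeq n + c * t| / (φ ^ n + ψ ^ n - t)
      ≤ n * 4 / (φ ^ n / 2) := by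
        gcongr
        have h1 := abs_le.1 hψ5
        have h3 := abs_le.1 hct
        exact abs_le.2 ⟨by linarith, by linarith⟩
    _ = 8 * (n / φ ^ n) := by
        ring

end Mobius

theorem avg_mis_mobius_two_by_n :
    Filter.Tendsto
      (fun n : ℕ => avgMIS (mobiusGraph 2 n) - ((1 + Real.sqrt 5) / 2 / Real.sqrt 5) * n)
      Filter.atTop (nhds 0) := by
  have hlim : Filter.Tendsto (fun n : ℕ => 8 * ((n : ℝ) / Real.goldenRatio ^ n))
      Filter.atTop (nhds 0) := by
    simpa using
      (tendsto_pow_const_div_const_pow_of_one_lt 1 Real.one_lt_goldenRatio).const_mul 8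
  refine squeeze_zero_norm' ?_ hlim
  filter_upwards [Filter.eventually_gt_atTop 0,
    (tendsto_pow_atTop_atTop_of_one_lt Real.one_lt_goldenRatio).eventually_ge_atTop 6]
    with n hn h
  exact Mobius.abs_avgMIS_sub_le hn h
end

section
/- Every maximal independent set of the fat grid cylinder B_{2×n} (n ≥ 3) has even cardinality. -/
open SimpleGraph Finset

/-- The fat grid cylinder `B_{m×n}`, the box product of a path graph and a cycle graph. -/
def fatCylinder (m n : ℕ) : SimpleGraph (Fin m × Fin n) := pathGraph m □ cycleGraph n

theorem fatCylinder_two_adj {k : ℕ} {u v : Fin 2 × Fin (k + 3)} :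
    (fatCylinder 2 (k + 3)).Adj u v ↔
      u.1 ≠ v.1 ∧ u.2 = v.2 ∨ (u.2 = v.2 + 1 ∨ v.2 = u.2 + 1) ∧ u.1 = v.1 := by
  simp [fatCylinder, pathGraph_two_eq_top, boxProd_adj, cycleGraph_adj, sub_eq_iff_eq_add']

theorem IsMaxIndep.exists_adj_of_notMem {V : Type*} {G : SimpleGraph V} {s : Finset V}
    (hs : IsMaxIndep G s) {v : V} (hv : v ∉ s) : ∃ u ∈ s, G.Adj v u := by
  classical
  by_contra! h
  refine hv ?_
  rw [hs.2 (insert v s) ?_ (subset_insert v s)]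
  · exact mem_insert_self v s
  · intro x hx y hy
    rw [mem_insert] at hx hy
    rcases hx with rfl | hx <;> rcases hy with rfl | hy
    · exact G.irrefl
    · exact h y hy
    · exact fun hxy => h x hx hxy.symm
    · exact hs.1 hx hy

/-- In a maximal independent set of `B_{2×n}`, the next occupied column after one occupied in
row `a` is occupied in the other row `b`, and it is at distance at most two. -/
theorem IsMaxIndep.mem_add_two_of_notMem_add_one {k : ℕ} {M : Finset (Fin 2 × Fin (k + 3))}
    (hM : IsMaxIndep (fatCylinder 2 (k + 3)) M) {a b : Fin 2} (hab : a ≠ b) {i : Fin (k + 3)}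
    (hi : (a, i) ∈ M) (hb : (b, i + 1) ∉ M) : (b, i + 1 + 1) ∈ M := by
  obtain ⟨⟨c, j⟩, hj, hadj⟩ := hM.exists_adj_of_notMem hb
  rw [fatCylinder_two_adj] at hadj
  rcases hadj with ⟨hc, rfl⟩ | ⟨h | rfl, rfl⟩
  · obtain rfl : a = c := by simp only at hc; omega
    exact absurd (fatCylinder_two_adj.2 (by simp)) (hM.1 hi hj)
  · obtain rfl : i = j := add_right_cancel h
    exact absurd (fatCylinder_two_adj.2 (by simp [hab])) (hM.1 hi hj)
  · exact hj

theorem IsMaxIndep.card_row_le {k : ℕ} {M : Finset (Fin 2 × Fin (k + 3))}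
    (hM : IsMaxIndep (fatCylinder 2 (k + 3)) M) {a b : Fin 2} (hab : a ≠ b) :
    #{x ∈ M | x.1 = a} ≤ #{x ∈ M | x.1 = b} := by
  have hconsec (i : Fin (k + 3)) (h : (a, i) ∈ M) : (a, i + 1) ∉ M := fun h' =>
    hM.1 h h' (fatCylinder_two_adj.2 (by simp))
  refine card_le_card_of_injOn
    (fun x => if (b, x.2 + 1) ∈ M then (b, x.2 + 1) else (b, x.2 + 1 + 1)) ?_ ?_
  · rintro ⟨c, i⟩ hx
    obtain ⟨hi, rfl⟩ : (c, i) ∈ M ∧ c = a := by simpa using hx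
    by_cases h : (b, i + 1) ∈ M
    · simp [h]
    · simp [h, hM.mem_add_two_of_notMem_add_one hab hi h]
  · rintro ⟨c, i⟩ hx ⟨d, j⟩ hy hxy
    obtain ⟨hi, rfl⟩ : (c, i) ∈ M ∧ c = a := by simpa using hx
    obtain ⟨hj, rfl⟩ : (d, j) ∈ M ∧ d = c := by simpa using hy
    dsimp only at hxy
    split_ifs at hxy
    · simpa using hxy
    · obtain rfl : i = j + 1 := by simpa using hxy
      exact absurd hi (hconsec j hj)
    · obtain rfl : i + 1 = j := by simpa using hxy
      exact absurd hj (hconsec i hi)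
    · simpa using hxy

theorem mis_fatCylinder_two_by_n_even_card (n : ℕ) (hn : 3 ≤ n)
    (M : Finset (Fin 2 × Fin n)) (hM : IsMaxIndep (fatCylinder 2 n) M) :
    Even M.card := by
  obtain ⟨k, rfl⟩ := Nat.exists_eq_add_of_le' hn
  refine ⟨#{x ∈ M | x.1 = 0}, ?_⟩
  have hrows : #{x ∈ M | x.1 = 0} = #{x ∈ M | x.1 = 1} :=
    (hM.card_row_le zero_ne_one).antisymm (hM.card_row_le one_ne_zero)
  have hcompl : {x ∈ M | ¬ x.1 = 0} = {x ∈ M | x.1 = 1} :=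
    filter_congr fun x _ => by omega
  rw [← card_filter_add_card_filter_not (s := M) (fun x => x.1 = 0), hcompl, hrows]
end
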